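/- arXiv:2211.16750 — 2 statements merged into one kernel-verified Lean document; each statement's English description precedes it below -/
import Mathlib

section
/- Let C be a finite nonempty set, D a natural number, q a strictly positive probability mass function on configurations x : Fin D → C, and f : Fin D → (Fin D → C) → C → ℝ any function with the 'hollow' property that f(d, x, c) = f(d, x', c) whenever x and x' agree on all coordinates other than d. Then ∑_{x} q(x) ∑_{d=1}^{D} ∑_{c∈C} q(X^d = c | x^{∖d}) · f(d, x, c) = ∑_{x} q(x) ∑_{d=1}^{D} f(d, x, x(d)), where q(X^d = c | x^{∖d}) := q(x[d↦c]) / ∑_{c'∈C} q(x[d↦c']) and x[d↦c] denotes x with its d-th coordinate replaced by c. -/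
open Finset

/-- The singleton conditional distribution
`q(X^d = c | x^{∖d}) = q(x[d↦c]) / ∑_{c'} q(x[d↦c'])`. -/
noncomputable def singletonCond {C : Type*} [Fintype C] {D : ℕ}
    (q : (Fin D → C) → ℝ) (d : Fin D) (x : Fin D → C) (c : C) : ℝ :=
  q (Function.update x d c) / ∑ c' : C, q (Function.update x d c')

/-- Exchanging the `i`-th coordinate of `x` with `c` is an involution on pairs `(x, c)`, so it
preserves sums over such pairs. -/
theorem sum_sum_update_swap {ι C M : Type*} [DecidableEq ι] [Fintype ι] [Fintype C]
    [AddCommMonoid M] (i : ι) (F : (ι → C) → C → M) :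
    ∑ x, ∑ c, F x c = ∑ x, ∑ c, F (Function.update x i c) (x i) := by
  rw [← Fintype.sum_prod_type', ← Fintype.sum_prod_type']
  have h : Function.Involutive
      (fun p : (ι → C) × C => (Function.update p.1 i p.2, p.1 i)) := by
    rintro ⟨x, c⟩
    simp
  exact (h.toPerm.sum_comp univ (fun p => F p.1 p.2) (by simp)).symm

/-- Averaging a function that ignores the `d`-th coordinate of `x` against the conditional
distribution of that coordinate does not change its expectation. -/
theorem sum_mul_sum_singletonCond_mul {C : Type*} [Fintype C] {D : ℕ}
    (q : (Fin D → C) → ℝ) (hq : ∀ x, 0 < q x) (d : Fin D) (g : (Fin D → C) → C → ℝ)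
    (hg : ∀ x c c', g (Function.update x d c') c = g x c) :
    ∑ x, q x * ∑ c, singletonCond q d x c * g x c = ∑ x, q x * g x (x d) := by
  simp_rw [mul_sum]
  rw [sum_sum_update_swap d]
  refine sum_congr rfl fun x _ => ?_
  have hZ : ∑ c, q (Function.update x d c) ≠ 0 :=
    (sum_pos (fun c _ => hq _) ⟨x d, mem_univ _⟩).ne'
  simp only [singletonCond, Function.update_idem, Function.update_eq_self, hg]
  rw [← sum_mul]
  field_simp

/-- **Proposition 4 (core identity).** For a strictly positive pmf `q` on `C^D` and any
"hollow" function `f` (whose value at dimension `d` does not depend on the `d`-th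
coordinate of its configuration argument),
`∑_x q(x) ∑_d ∑_c q(X^d=c|x^{∖d}) f(d,x,c) = ∑_x q(x) ∑_d f(d,x,x(d))`. -/
theorem categorical_ratio_matching_identity
    {C : Type*} [Fintype C] [Nonempty C] {D : ℕ}
    (q : (Fin D → C) → ℝ) (hqpos : ∀ x, 0 < q x) (hqsum : ∑ x, q x = 1)
    (f : Fin D → (Fin D → C) → C → ℝ)
    (hhollow : ∀ (d : Fin D) (x x' : Fin D → C) (c : C),
      (∀ i, i ≠ d → x i = x' i) → f d x c = f d x' c) :
    ∑ x, q x * ∑ d : Fin D, ∑ c : C, singletonCond q d x c * f d x c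
      = ∑ x, q x * ∑ d : Fin D, f d x (x d) := by
  simp_rw [mul_sum (s := (univ : Finset (Fin D)))]
  refine sum_comm.trans (Eq.trans ?_ sum_comm)
  refine sum_congr rfl fun d _ => sum_mul_sum_singletonCond_mul q hqpos d (f d) fun x c c' => ?_
  exact hhollow d _ _ c fun i hi => Function.update_of_ne hi c' x
end

section
/- Let C be a finite nonempty set, D a natural number, and q a strictly positive probability mass function on configurations x : Fin D → C. For each dimension d and configuration x, let p(d, x, ·) : C → ℝ be a strictly positive probability mass function on C that depends on x only through coordinates other than d (p(d, x, c) = p(d, x', c) whenever x and x' agree off coordinate d). Define J(p) := ∑_{x} q(x) ∑_{d=1}^{D} ( −∑_{c∈C} q(X^d = c | x^{∖d}) · log p(d, x, c) ), where q(X^d = c | x^{∖d}) := q(x[d↦c]) / ∑_{c'} q(x[d↦c']) and x[d↦c] denotes x with its d-th coordinate replaced by c. Then J(p) ≥ J(q̄), where q̄(d, x, c) := q(X^d = c | x^{∖d}), with equality if and only if p(d, x, c) = q(X^d = c | x^{∖d}) for all d, x, c. -/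
open Finset

/-- The expected cross entropy `J(p)` between the true singleton conditionals of `q` and
a family of model conditionals `p`. -/
noncomputable def crossEntropyLoss {C : Type*} [Fintype C] {D : ℕ}
    (q : (Fin D → C) → ℝ) (p : Fin D → (Fin D → C) → C → ℝ) : ℝ :=
  ∑ x, q x * ∑ d : Fin D, -∑ c : C, singletonCond q d x c * Real.log (p d x c)

theorem mul_log_sub_mul_log_le {a b : ℝ} (ha : 0 < a) (hb : 0 < b) :
    a * Real.log b - a * Real.log a ≤ b - a := by
  have h := mul_le_mul_of_nonneg_left (Real.log_le_sub_one_of_pos (div_pos hb ha)) ha.le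
  rw [Real.log_div hb.ne' ha.ne', mul_sub, mul_sub, mul_div_cancel₀ _ ha.ne'] at h
  linarith

theorem eq_of_mul_log_sub_mul_log_eq {a b : ℝ} (ha : 0 < a) (hb : 0 < b)
    (h : a * Real.log b - a * Real.log a = b - a) : b = a := by
  by_contra hne
  have hlt := mul_lt_mul_of_pos_left (Real.log_lt_sub_one_of_pos (div_pos hb ha)
    (fun h1 => hne ((div_eq_one_iff_eq ha.ne').mp h1))) ha
  rw [Real.log_div hb.ne' ha.ne', mul_sub, mul_sub, mul_div_cancel₀ _ ha.ne'] at hlt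
  linarith

/-- Gibbs' inequality for strictly positive weights of equal total mass. -/
theorem neg_sum_mul_log_self_le {ι : Type*} [Fintype ι] {a b : ι → ℝ}
    (ha : ∀ i, 0 < a i) (hb : ∀ i, 0 < b i) (hab : ∑ i, a i = ∑ i, b i) :
    -∑ i, a i * Real.log (a i) ≤ -∑ i, a i * Real.log (b i) := by
  have h := Finset.sum_le_sum fun i (_ : i ∈ Finset.univ) => mul_log_sub_mul_log_le (ha i) (hb i)
  simp only [Finset.sum_sub_distrib] at h
  linarith

/-- The equality case of Gibbs' inequality. -/
theorem eq_of_neg_sum_mul_log_self_eq {ι : Type*} [Fintype ι] {a b : ι → ℝ}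
    (ha : ∀ i, 0 < a i) (hb : ∀ i, 0 < b i) (hab : ∑ i, a i = ∑ i, b i)
    (h : -∑ i, a i * Real.log (a i) = -∑ i, a i * Real.log (b i)) (i : ι) : b i = a i := by
  have hsum : ∑ i, (a i * Real.log (b i) - a i * Real.log (a i)) = ∑ i, (b i - a i) := by
    simp only [Finset.sum_sub_distrib]
    linarith
  exact eq_of_mul_log_sub_mul_log_eq (ha i) (hb i)
    ((Finset.sum_eq_sum_iff_of_le fun i _ => mul_log_sub_mul_log_le (ha i) (hb i)).mp hsum i
      (Finset.mem_univ i))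

theorem sum_update_pos {C : Type*} [Fintype C] [Nonempty C] {D : ℕ}
    {q : (Fin D → C) → ℝ} (hq : ∀ x, 0 < q x) (d : Fin D) (x : Fin D → C) :
    0 < ∑ c : C, q (Function.update x d c) :=
  Finset.sum_pos (fun _ _ => hq _) Finset.univ_nonempty

theorem singletonCond_pos {C : Type*} [Fintype C] [Nonempty C] {D : ℕ}
    {q : (Fin D → C) → ℝ} (hq : ∀ x, 0 < q x) (d : Fin D) (x : Fin D → C) (c : C) :
    0 < singletonCond q d x c :=
  div_pos (hq _) (sum_update_pos hq d x)

theorem sum_singletonCond {C : Type*} [Fintype C] [Nonempty C] {D : ℕ}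
    {q : (Fin D → C) → ℝ} (hq : ∀ x, 0 < q x) (d : Fin D) (x : Fin D → C) :
    ∑ c : C, singletonCond q d x c = 1 := by
  simp only [singletonCond]
  rw [← Finset.sum_div, div_self (sum_update_pos hq d x).ne']

/-- **Optimality of categorical ratio matching.** The expected cross entropy between the
true singleton conditionals of a strictly positive pmf `q` on `C^D` and any family of
strictly positive model conditionals `p` (each not depending on the current value at its
own dimension) is at least that attained by the true conditionals themselves, with
equality iff `p(d,x,c) = q(X^d = c | x^{∖d})` for all `d, x, c`. -/
theorem cross_entropy_minimized_by_true_conditionals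
    {C : Type*} [Fintype C] [Nonempty C] {D : ℕ}
    (q : (Fin D → C) → ℝ) (hqpos : ∀ x, 0 < q x) (hqsum : ∑ x, q x = 1)
    (p : Fin D → (Fin D → C) → C → ℝ)
    (hppos : ∀ d x c, 0 < p d x c)
    (hpsum : ∀ d x, ∑ c : C, p d x c = 1)
    (hhollow : ∀ (d : Fin D) (x x' : Fin D → C) (c : C),
      (∀ i, i ≠ d → x i = x' i) → p d x c = p d x' c) :
    crossEntropyLoss q p ≥ crossEntropyLoss q (singletonCond q)
      ∧ (crossEntropyLoss q p = crossEntropyLoss q (singletonCond q)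
          ↔ ∀ d x c, p d x c = singletonCond q d x c) := by
  have hmass (d : Fin D) (x : Fin D → C) : ∑ c, singletonCond q d x c = ∑ c, p d x c := by
    rw [sum_singletonCond hqpos, hpsum]
  have hterm (d : Fin D) (x : Fin D → C) :=
    neg_sum_mul_log_self_le (singletonCond_pos hqpos d x) (hppos d x) (hmass d x)
  have hctx (x : Fin D → C) :=
    Finset.sum_le_sum fun d (_ : d ∈ (Finset.univ : Finset (Fin D))) => hterm d x
  have hweighted (x : Fin D → C) := mul_le_mul_of_nonneg_left (hctx x) (hqpos x).le
  refine ⟨Finset.sum_le_sum fun x _ => hweighted x, fun h d x c => ?_, fun h => ?_⟩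
  · have hx := (Finset.sum_eq_sum_iff_of_le fun x _ => hweighted x).mp h.symm x (Finset.mem_univ x)
    have hd := (Finset.sum_eq_sum_iff_of_le fun d _ => hterm d x).mp
      (mul_left_cancel₀ (hqpos x).ne' hx) d (Finset.mem_univ d)
    exact eq_of_neg_sum_mul_log_self_eq (singletonCond_pos hqpos d x) (hppos d x) (hmass d x) hd c
  · rw [show p = singletonCond q from funext fun d => funext fun x => funext fun c => h d x c]
end
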